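/- Let ω be a subadditive weight function. Let A be an invertible d×d real matrix, b ∈ [0,1), and let θ = (θ₁,…,θ_d):ℝ^d→ℝ^d be smooth with ∂θ_i/∂x_j ∈ B_{L∞,ω}(ℝ^d) for all 1 ≤ i, j ≤ d and |θ(x)| = O(|x|^b) as |x|→∞. Set ψ(x) = Ax + θ(x). Then for every f ∈ S_ω(ℝ^d) the composition f∘ψ belongs to S_ω(ℝ^d); that is, the composition operator C_ψ : S_ω(ℝ^d) → S_ω(ℝ^d) is well defined. -/

import Mathlib

open MeasureTheory

/-- A subadditive weight function in the sense of Braun–Meise–Taylor. -/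
structure IsWeightFunction (ω : ℝ → ℝ) : Prop where
  continuous : Continuous ω
  monotone : MonotoneOn ω (Set.Ici 0)
  nonneg : ∀ t : ℝ, 0 ≤ t → 0 ≤ ω t
  subadditive : ∀ s t : ℝ, 0 ≤ s → 0 ≤ t → ω (s + t) ≤ ω s + ω t
  integral : IntegrableOn (fun t : ℝ => ω t / (1 + t ^ 2)) (Set.Ioi 0)
  growth : (fun t : ℝ => Real.log (1 + t ^ 2)) =o[Filter.atTop] ω
  convex : ConvexOn ℝ Set.univ fun t : ℝ => ω (Real.exp t)

/-- The Young conjugate `φ*_ω(s) = sup_{t ≥ 0} (s·t − ω(eᵗ))`. -/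
noncomputable def youngConj (ω : ℝ → ℝ) (s : ℝ) : ℝ :=
  sSup ((fun t : ℝ => s * t - ω (Real.exp t)) '' Set.Ici 0)

/-- Membership in the class `B_{L∞,ω}(ℝ^d)`. -/
def InBomega (ω : ℝ → ℝ) {d : ℕ} (f : EuclideanSpace ℝ (Fin d) → ℝ) : Prop :=
  ContDiff ℝ (⊤ : ℕ∞) f ∧ ∀ m : ℕ, 1 ≤ m → ∃ C > 0, ∀ (n : ℕ) (x : EuclideanSpace ℝ (Fin d)),
    ‖iteratedFDeriv ℝ n f x‖ ≤ C * Real.exp ((m : ℝ) * youngConj ω ((n : ℝ) / m))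

/-- Membership in the Gelfand–Shilov space `S_ω(ℝ^d)`. -/
def InSomegaD (ω : ℝ → ℝ) {d : ℕ} (f : EuclideanSpace ℝ (Fin d) → ℂ) : Prop :=
  ContDiff ℝ (⊤ : ℕ∞) f ∧ ∀ lam > (0 : ℝ), ∀ mu > (0 : ℝ), ∃ C : ℝ,
    ∀ (n : ℕ) (x : EuclideanSpace ℝ (Fin d)),
      ‖iteratedFDeriv ℝ n f x‖ ≤
        C * Real.exp (lam * youngConj ω ((n : ℝ) / lam) - mu * ω ‖x‖)

/-- The weight sequence `exp (lam φ*_ω (n / lam))`, which equals `sup_{t ≥ 1} tⁿ exp (-lam ω(t))`. -/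
noncomputable def weightSeq (ω : ℝ → ℝ) (lam : ℝ) (n : ℕ) : ℝ :=
  Real.exp (lam * youngConj ω ((n : ℝ) / lam))

lemma weightSeq_pos (ω : ℝ → ℝ) (lam : ℝ) (n : ℕ) : 0 < weightSeq ω lam n :=
  Real.exp_pos _

namespace IsWeightFunction

variable {ω : ℝ → ℝ}

lemma natCast_mul_le (hω : IsWeightFunction ω) {K : ℕ} (hK : 1 ≤ K) {t : ℝ} (ht : 0 ≤ t) :
    ω (K * t) ≤ K * ω t := by
  induction K, hK using Nat.le_induction with
  | base => simp
  | succ k _ ih =>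
    have h := hω.subadditive (k * t) t (by positivity) ht
    push_cast
    rw [add_mul, add_mul, one_mul, one_mul]
    linarith

lemma bddAbove_youngConj (hω : IsWeightFunction ω) (s : ℝ) :
    BddAbove ((fun t : ℝ => s * t - ω (Real.exp t)) '' Set.Ici 0) := by
  have hc : (0 : ℝ) < 1 / (|s| + 1) := by positivity
  obtain ⟨X, hX⟩ := Filter.eventually_atTop.1 (hω.growth.def hc)
  refine ⟨|s| * |Real.log (max X 1)|, ?_⟩
  rintro _ ⟨t, ht, rfl⟩
  have ht0 : (0 : ℝ) ≤ t := ht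
  have hst : s * t ≤ |s| * t := mul_le_mul_of_nonneg_right (le_abs_self s) ht0
  have hω0 : 0 ≤ ω (Real.exp t) := hω.nonneg _ (Real.exp_pos t).le
  rcases le_total X (Real.exp t) with h | h
  · have h1 := hX _ h
    have h2 : t ≤ Real.log (1 + Real.exp t ^ 2) := by
      rw [Real.le_log_iff_exp_le (by positivity)]
      nlinarith [sq_nonneg (Real.exp t - 1), Real.exp_pos t]
    rw [Real.norm_of_nonneg (ht0.trans h2), Real.norm_of_nonneg hω0, div_mul_eq_mul_div, one_mul,
      le_div_iff₀ (by positivity)] at h1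
    have h3 : 0 ≤ |s| * |Real.log (max X 1)| := by positivity
    have h4 : t * (|s| + 1) ≤ Real.log (1 + Real.exp t ^ 2) * (|s| + 1) := by gcongr
    change s * t - ω (Real.exp t) ≤ _
    nlinarith
  · have h1 : t ≤ |Real.log (max X 1)| := by
      refine le_trans ?_ (le_abs_self _)
      rw [Real.le_log_iff_exp_le (by positivity)]
      exact h.trans (le_max_left _ _)
    have h2 : |s| * t ≤ |s| * |Real.log (max X 1)| := by gcongr
    change s * t - ω (Real.exp t) ≤ _
    linarith

lemma pow_mul_exp_le_weightSeq (hω : IsWeightFunction ω) {lam : ℝ} (hlam : 0 < lam) (n : ℕ)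
    {t : ℝ} (ht : 1 ≤ t) : t ^ n * Real.exp (-(lam * ω t)) ≤ weightSeq ω lam n := by
  have ht0 : 0 < t := by linarith
  have h := le_csSup (hω.bddAbove_youngConj ((n : ℝ) / lam))
    (Set.mem_image_of_mem _ (Set.mem_Ici.2 (Real.log_nonneg ht)))
  simp only [Real.exp_log ht0] at h
  have hpow : t ^ n = Real.exp (n * Real.log t) := by
    rw [Real.exp_nat_mul, Real.exp_log ht0]
  rw [hpow, ← Real.exp_add, weightSeq, Real.exp_le_exp, youngConj]
  calc n * Real.log t + -(lam * ω t) = lam * ((n : ℝ) / lam * Real.log t - ω t) := by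
        field_simp
        ring
    _ ≤ _ := by gcongr

end IsWeightFunction

lemma weightSeq_le_of_forall {ω : ℝ → ℝ} {lam : ℝ} (hlam : 0 < lam) {n : ℕ} {B : ℝ}
    (h : ∀ t : ℝ, 1 ≤ t → t ^ n * Real.exp (-(lam * ω t)) ≤ B) : weightSeq ω lam n ≤ B := by
  have hB : 0 < B := lt_of_lt_of_le (by positivity) (h 1 le_rfl)
  rw [weightSeq, ← Real.le_log_iff_exp_le hB, ← le_div_iff₀' hlam, youngConj]
  refine csSup_le (Set.nonempty_Ici.image _) ?_
  rintro _ ⟨t, ht, rfl⟩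
  have h1 := h (Real.exp t) (Real.one_le_exp ht)
  rw [← Real.exp_nat_mul, ← Real.exp_add, ← Real.le_log_iff_exp_le hB] at h1
  rw [le_div_iff₀' hlam]
  refine le_trans (le_of_eq ?_) h1
  field_simp
  ring

namespace IsWeightFunction

variable {ω : ℝ → ℝ}

lemma choose_mul_weightSeq_mul_le (hω : IsWeightFunction ω) {lam : ℝ} (hlam : 0 < lam)
    (j k : ℕ) : ((j + k).choose j : ℝ) * weightSeq ω lam j * weightSeq ω lam k
      ≤ weightSeq ω lam (j + k) := by
  have hc : (0 : ℝ) < (j + k).choose j := by exact_mod_cast Nat.choose_pos (Nat.le_add_right j k)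
  have hk := weightSeq_pos ω lam k
  have key : ∀ s : ℝ, 1 ≤ s → ∀ t : ℝ, 1 ≤ t → ((j + k).choose j : ℝ) *
      (s ^ j * Real.exp (-(lam * ω s))) * (t ^ k * Real.exp (-(lam * ω t)))
        ≤ weightSeq ω lam (j + k) := by
    intro s hs t ht
    have hs0 : 0 ≤ s := by linarith
    have ht0 : 0 ≤ t := by linarith
    have hpow : s ^ j * t ^ k * ((j + k).choose j : ℝ) ≤ (s + t) ^ (j + k) := by
      rw [add_pow]
      refine le_trans (le_of_eq ?_) (Finset.single_le_sum (s := Finset.range (j + k + 1))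
        (f := fun m => s ^ m * t ^ (j + k - m) * ((j + k).choose m : ℝ))
        (fun i _ => by positivity) (Finset.mem_range.2 (by omega : j < j + k + 1)))
      simp
    have hexp : Real.exp (-(lam * ω s)) * Real.exp (-(lam * ω t))
        ≤ Real.exp (-(lam * ω (s + t))) := by
      rw [← Real.exp_add, Real.exp_le_exp]
      nlinarith [hω.subadditive s t hs0 ht0]
    calc ((j + k).choose j : ℝ) * (s ^ j * Real.exp (-(lam * ω s)))
          * (t ^ k * Real.exp (-(lam * ω t)))
        = (s ^ j * t ^ k * ((j + k).choose j : ℝ))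
          * (Real.exp (-(lam * ω s)) * Real.exp (-(lam * ω t))) := by ring
      _ ≤ (s + t) ^ (j + k) * Real.exp (-(lam * ω (s + t))) := by gcongr
      _ ≤ _ := hω.pow_mul_exp_le_weightSeq hlam _ (by linarith)
  have h1 : ∀ s : ℝ, 1 ≤ s → ((j + k).choose j : ℝ) *
      (s ^ j * Real.exp (-(lam * ω s))) * weightSeq ω lam k ≤ weightSeq ω lam (j + k) := by
    intro s hs
    have hp : 0 < ((j + k).choose j : ℝ) * (s ^ j * Real.exp (-(lam * ω s))) := by positivity
    rw [← le_div_iff₀' hp]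
    refine weightSeq_le_of_forall hlam fun t ht => ?_
    rw [le_div_iff₀' hp]
    exact key s hs t ht
  rw [mul_right_comm, ← le_div_iff₀' (by positivity)]
  refine weightSeq_le_of_forall hlam fun s hs => ?_
  rw [le_div_iff₀' (by positivity), mul_right_comm]
  exact h1 s hs

lemma pow_mul_weightSeq_le (hω : IsWeightFunction ω) {K : ℕ} (hK : 1 ≤ K) {lam mu : ℝ}
    (hlam : 0 < lam) (hmu : K * lam ≤ mu) (n : ℕ) :
    (K : ℝ) ^ n * weightSeq ω mu n ≤ weightSeq ω lam n := by
  have hK1 : (1 : ℝ) ≤ K := by exact_mod_cast hK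
  have hmu0 : 0 < mu := lt_of_lt_of_le (by positivity) hmu
  rw [← le_div_iff₀' (by positivity)]
  refine weightSeq_le_of_forall hmu0 fun t ht => ?_
  have ht0 : 0 ≤ t := by linarith
  rw [le_div_iff₀' (by positivity), ← mul_assoc, ← mul_pow]
  refine le_trans ?_ (hω.pow_mul_exp_le_weightSeq hlam n (t := K * t) (by nlinarith))
  refine mul_le_mul_of_nonneg_left (Real.exp_le_exp.2 ?_) (by positivity)
  have h1 := mul_le_mul_of_nonneg_left (hω.natCast_mul_le hK ht0) hlam.le
  have h2 := mul_le_mul_of_nonneg_right hmu (hω.nonneg t ht0)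
  nlinarith

lemma weightSeq_div_factorial_mul_le (hω : IsWeightFunction ω) {lam : ℝ} (hlam : 0 < lam)
    (j k : ℕ) : weightSeq ω lam j / j.factorial * (weightSeq ω lam k / k.factorial)
      ≤ weightSeq ω lam (j + k) / (j + k).factorial := by
  have h := hω.choose_mul_weightSeq_mul_le hlam j k
  have hf : ((j + k).choose j : ℝ) * j.factorial * k.factorial = (j + k).factorial := by
    rw [Nat.choose_symm_add]
    exact_mod_cast Nat.add_choose_mul_factorial_mul_factorial j k
  rw [div_mul_div_comm, div_le_div_iff₀ (by positivity) (by positivity), ← hf]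
  calc weightSeq ω lam j * weightSeq ω lam k
        * (((j + k).choose j : ℝ) * j.factorial * k.factorial)
      = (((j + k).choose j : ℝ) * weightSeq ω lam j * weightSeq ω lam k)
        * (j.factorial * k.factorial) := by ring
    _ ≤ _ := by gcongr

lemma weightSeq_div_factorial_mul_prod_le (hω : IsWeightFunction ω) {lam : ℝ} (hlam : 0 < lam)
    {ι : Type*} (a : ℕ) (b : ι → ℕ) (s : Finset ι) :
    weightSeq ω lam a / a.factorial * ∏ i ∈ s, (weightSeq ω lam (b i) / (b i).factorial)
      ≤ weightSeq ω lam (a + ∑ i ∈ s, b i) / (a + ∑ i ∈ s, b i).factorial := by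
  classical
  induction s using Finset.induction_on with
  | empty => simp
  | insert i s hi ih =>
    rw [Finset.prod_insert hi, Finset.sum_insert hi, mul_left_comm, Nat.add_left_comm]
    refine le_trans ?_ (hω.weightSeq_div_factorial_mul_le hlam _ _)
    have := weightSeq_pos ω lam (b i)
    gcongr

end IsWeightFunction

namespace OrderedFinpartition

lemma sum_partSize {n : ℕ} (c : OrderedFinpartition n) : ∑ i, c.partSize i = n := by
  simpa using c.sum_sigma_eq_sum (fun _ => (1 : ℕ))

lemma length_add_sum_partSize_sub_one {n : ℕ} (c : OrderedFinpartition n) :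
    c.length + ∑ i, (c.partSize i - 1) = n := by
  have h : ∑ i, (c.partSize i - 1 + 1) = n :=
    (Finset.sum_congr rfl fun i _ => Nat.sub_add_cancel (c.partSize_pos i)).trans c.sum_partSize
  rw [Finset.sum_add_distrib] at h
  simp at h
  omega

/-- The number of ways to order the parts, and the elements within each part but the first. -/
def factorialWeight {n : ℕ} (c : OrderedFinpartition n) : ℕ :=
  c.length.factorial * ∏ i, (c.partSize i - 1).factorial

lemma factorialWeight_extendLeft {n : ℕ} (c : OrderedFinpartition n) :
    c.extendLeft.factorialWeight = (c.length + 1) * c.factorialWeight := by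
  have h : ∏ i, (c.extendLeft.partSize i - 1).factorial
      = ∏ i, (c.partSize i - 1).factorial := by
    change ∏ i : Fin (c.length + 1), ((Fin.cons 1 c.partSize : Fin (c.length + 1) → ℕ) i
      - 1).factorial = _
    simp [Fin.prod_univ_succ]
  rw [factorialWeight, factorialWeight, h, extendLeft_length, Nat.factorial_succ, mul_assoc]

lemma factorialWeight_extendMiddle {n : ℕ} (c : OrderedFinpartition n) (k : Fin c.length) :
    (c.extendMiddle k).factorialWeight = c.partSize k * c.factorialWeight := by
  have h : ∏ i, ((c.extendMiddle k).partSize i - 1).factorial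
      = c.partSize k * ∏ i, (c.partSize i - 1).factorial := by
    change ∏ i : Fin c.length, ((Function.update c.partSize k (c.partSize k + 1)) i
      - 1).factorial = _
    rw [← Finset.mul_prod_erase _ _ (Finset.mem_univ k),
      ← Finset.mul_prod_erase _ (fun i => (c.partSize i - 1).factorial) (Finset.mem_univ k),
      ← mul_assoc]
    congr 1
    · rw [Function.update_self, Nat.add_sub_cancel,
        Nat.mul_factorial_pred (c.partSize_pos k).ne']
    · refine Finset.prod_congr rfl fun i hi => ?_
      rw [Function.update_of_ne (Finset.ne_of_mem_erase hi)]
  rw [factorialWeight, factorialWeight, h, extendMiddle_length, mul_left_comm]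

lemma sum_factorialWeight_le (n : ℕ) :
    ∑ c : OrderedFinpartition n, c.factorialWeight ≤ 2 ^ n * n.factorial := by
  induction n with
  | zero => simp [factorialWeight]
  | succ n ih =>
    rw [← (extendEquiv n).sum_comp, Fintype.sum_sigma]
    calc ∑ c : OrderedFinpartition n, ∑ o : Option (Fin c.length),
          (extendEquiv n ⟨c, o⟩).factorialWeight
        = ∑ c : OrderedFinpartition n, (c.length + 1 + n) * c.factorialWeight := by
          refine Finset.sum_congr rfl fun c _ => ?_
          simp only [extendEquiv_apply, Fintype.sum_option, extend_none, extend_some,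
            factorialWeight_extendLeft, factorialWeight_extendMiddle]
          rw [← Finset.sum_mul, c.sum_partSize, add_mul (c.length + 1)]
      _ ≤ ∑ c : OrderedFinpartition n, (2 * (n + 1)) * c.factorialWeight := by
          refine Finset.sum_le_sum fun c _ => Nat.mul_le_mul_right _ ?_
          have := c.length_le
          omega
      _ = (2 * (n + 1)) * ∑ c : OrderedFinpartition n, c.factorialWeight := by
          rw [Finset.mul_sum]
      _ ≤ (2 * (n + 1)) * (2 ^ n * n.factorial) := Nat.mul_le_mul_left _ ih
      _ = 2 ^ (n + 1) * (n + 1).factorial := by rw [Nat.factorial_succ, pow_succ]; ring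

end OrderedFinpartition

/-- Faà di Bruno bound with the derivatives of the outer function and the shifted derivatives of
the inner function controlled by the same weight sequence. -/
lemma IsWeightFunction.sum_orderedFinpartition_weightSeq_le {ω : ℝ → ℝ}
    (hω : IsWeightFunction ω) {lam : ℝ} (hlam : 0 < lam) (n : ℕ) :
    ∑ c : OrderedFinpartition n,
        weightSeq ω lam c.length * ∏ i, weightSeq ω lam (c.partSize i - 1)
      ≤ 2 ^ n * weightSeq ω lam n := by
  have hterm : ∀ c : OrderedFinpartition n,
      weightSeq ω lam c.length * ∏ i, weightSeq ω lam (c.partSize i - 1)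
        ≤ c.factorialWeight * (weightSeq ω lam n / n.factorial) := by
    intro c
    have h := hω.weightSeq_div_factorial_mul_prod_le hlam c.length
      (fun i => c.partSize i - 1) Finset.univ
    rw [c.length_add_sum_partSize_sub_one, Finset.prod_div_distrib, div_mul_div_comm,
      div_le_iff₀ (by positivity)] at h
    rw [OrderedFinpartition.factorialWeight]
    push_cast
    linarith
  have hn := weightSeq_pos ω lam n
  calc _ ≤ ∑ c : OrderedFinpartition n,
        (c.factorialWeight : ℝ) * (weightSeq ω lam n / n.factorial) :=
        Finset.sum_le_sum fun c _ => hterm c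
    _ = ((∑ c : OrderedFinpartition n, c.factorialWeight : ℕ) : ℝ)
        * (weightSeq ω lam n / n.factorial) := by rw [← Finset.sum_mul, Nat.cast_sum]
    _ ≤ ((2 ^ n * n.factorial : ℕ) : ℝ) * (weightSeq ω lam n / n.factorial) := by
        gcongr
        exact OrderedFinpartition.sum_factorialWeight_le n
    _ = 2 ^ n * weightSeq ω lam n := by
        push_cast
        field_simp

lemma norm_iteratedFDeriv_comp_le_sum_orderedFinpartition
    {E F G : Type*} [NormedAddCommGroup E] [NormedSpace ℝ E] [NormedAddCommGroup F]
    [NormedSpace ℝ F] [NormedAddCommGroup G] [NormedSpace ℝ G] {g : F → G} {f : E → F}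
    (hg : ContDiff ℝ (⊤ : ℕ∞) g) (hf : ContDiff ℝ (⊤ : ℕ∞) f) (n : ℕ) (x : E) :
    ‖iteratedFDeriv ℝ n (g ∘ f) x‖ ≤ ∑ c : OrderedFinpartition n,
      ‖iteratedFDeriv ℝ c.length g (f x)‖ * ∏ i, ‖iteratedFDeriv ℝ (c.partSize i) f x‖ := by
  rw [iteratedFDeriv_comp hg.contDiffAt hf.contDiffAt (by exact_mod_cast le_top)]
  exact (norm_sum_le _ _).trans
    (Finset.sum_le_sum fun c _ => c.norm_compAlongOrderedFinpartition_le _ _)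

lemma fderiv_eq_sum_coord {d : ℕ} {θ : EuclideanSpace ℝ (Fin d) → EuclideanSpace ℝ (Fin d)}
    (hθ : Differentiable ℝ θ) (x : EuclideanSpace ℝ (Fin d)) :
    fderiv ℝ θ x = ∑ i : Fin d, ∑ j : Fin d,
      fderiv ℝ (fun u => θ u i) x (EuclideanSpace.single j (1 : ℝ)) •
        (EuclideanSpace.proj j : EuclideanSpace ℝ (Fin d) →L[ℝ] ℝ).smulRight
          (EuclideanSpace.single i (1 : ℝ)) := by
  have hcoord : ∀ (i : Fin d) (v : EuclideanSpace ℝ (Fin d)),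
      fderiv ℝ (fun u => θ u i) x v = fderiv ℝ θ x v i := by
    intro i v
    have h := ((EuclideanSpace.proj i : EuclideanSpace ℝ (Fin d) →L[ℝ] ℝ).hasFDerivAt.comp x
      (hθ x).hasFDerivAt).fderiv
    change fderiv ℝ (fun u => θ u i) x = _ at h
    rw [h]
    rfl
  ext v k
  have hv : v = ∑ j : Fin d, v j • EuclideanSpace.single j (1 : ℝ) := by
    ext l
    simp [Pi.single_apply]
  simp only [hcoord]
  conv_lhs => rw [hv]
  simp [Pi.single_apply, mul_comm]

/-- The derivatives of order `n + 1` of `A + θ` are controlled by the weight sequence at `n`. -/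
lemma exists_norm_iteratedFDeriv_add_le {ω : ℝ → ℝ} (hω : IsWeightFunction ω) {d : ℕ}
    (A : EuclideanSpace ℝ (Fin d) →L[ℝ] EuclideanSpace ℝ (Fin d))
    {θ : EuclideanSpace ℝ (Fin d) → EuclideanSpace ℝ (Fin d)} (hθ : ContDiff ℝ (⊤ : ℕ∞) θ)
    (hθ' : ∀ i j : Fin d, InBomega ω
      (fun x => fderiv ℝ (fun u => θ u i) x (EuclideanSpace.single j (1 : ℝ))))
    {m : ℕ} (hm : 1 ≤ m) :
    ∃ C : ℝ, ∀ (n : ℕ) (x : EuclideanSpace ℝ (Fin d)),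
      ‖iteratedFDeriv ℝ (n + 1) (fun x => A x + θ x) x‖ ≤ C * weightSeq ω m n := by
  have hm0 : (0 : ℝ) < m := by exact_mod_cast hm
  choose C hC0 hC using fun i j => (hθ' i j).2 m hm
  let T : Fin d → Fin d → EuclideanSpace ℝ (Fin d) →L[ℝ] EuclideanSpace ℝ (Fin d) := fun i j =>
    (EuclideanSpace.proj j : EuclideanSpace ℝ (Fin d) →L[ℝ] ℝ).smulRight
      (EuclideanSpace.single i (1 : ℝ))
  let g : Fin d → Fin d → EuclideanSpace ℝ (Fin d) → ℝ := fun i j x =>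
    fderiv ℝ (fun u => θ u i) x (EuclideanSpace.single j (1 : ℝ))
  have hdiff : Differentiable ℝ θ := hθ.differentiable (by simp)
  have hfd : fderiv ℝ (fun x => A x + θ x) = fun x => A + ∑ i, ∑ j, g i j x • T i j := by
    funext x
    rw [fderiv_fun_add A.differentiableAt (hdiff x), A.fderiv, fderiv_eq_sum_coord hdiff]
  have hg : ∀ i j (n : ℕ), ContDiff ℝ n (fun x => g i j x • T i j) := fun i j n =>
    ((hθ' i j).1.of_le (by exact_mod_cast le_top)).smul contDiff_const
  have hterm : ∀ i j (n : ℕ) x, ‖iteratedFDeriv ℝ n (fun x => g i j x • T i j) x‖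
      ≤ ‖T i j‖ * C i j * weightSeq ω m n := by
    intro i j n x
    have h := ((ContinuousLinearMap.id ℝ ℝ).smulRight (T i j)).norm_iteratedFDeriv_comp_left
      (f := g i j) (x := x) (n := n) (N := n)
      ((hθ' i j).1.of_le (by exact_mod_cast le_top)).contDiffAt le_rfl
    have hT : ‖(ContinuousLinearMap.id ℝ ℝ).smulRight (T i j)‖ ≤ ‖T i j‖ := by
      rw [ContinuousLinearMap.norm_smulRight_apply]
      exact mul_le_of_le_one_left (norm_nonneg _) ContinuousLinearMap.norm_id_le
    refine h.trans ?_
    rw [mul_assoc]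
    exact mul_le_mul hT (hC i j n x) (norm_nonneg _) (norm_nonneg _)
  have hA : ∀ (n : ℕ) x, ‖iteratedFDeriv ℝ n
      (fun _ : EuclideanSpace ℝ (Fin d) => A) x‖ ≤ ‖A‖ * Real.exp (m * ω 1) * weightSeq ω m n := by
    intro n x
    have h1 : 1 ≤ Real.exp (m * ω 1) * weightSeq ω m n := by
      have h := hω.pow_mul_exp_le_weightSeq hm0 n le_rfl
      rw [one_pow, one_mul, Real.exp_neg, inv_le_iff_one_le_mul₀ (Real.exp_pos _)] at h
      linarith
    have h2 : ‖iteratedFDeriv ℝ n (fun _ : EuclideanSpace ℝ (Fin d) => A) x‖ ≤ ‖A‖ := by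
      rcases n with _ | n
      · rw [norm_iteratedFDeriv_zero]
      · simp [iteratedFDeriv_succ_const]
    rw [mul_assoc]
    exact h2.trans (le_mul_of_one_le_right (norm_nonneg _) h1)
  refine ⟨‖A‖ * Real.exp (m * ω 1) + ∑ i, ∑ j, ‖T i j‖ * C i j, fun n x => ?_⟩
  rw [← norm_iteratedFDeriv_fderiv, hfd,
    fun_iteratedFDeriv_add_apply contDiffAt_const
      (ContDiff.sum fun i _ => ContDiff.sum fun j _ => hg i j n).contDiffAt,
    iteratedFDeriv_sum fun i _ => ContDiff.sum fun j _ => hg i j n, Finset.sum_apply, add_mul,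
    Finset.sum_mul]
  refine (norm_add_le _ _).trans (add_le_add (hA n x) ((norm_sum_le _ _).trans
    (Finset.sum_le_sum fun i _ => ?_)))
  rw [iteratedFDeriv_sum fun j _ => hg i j n, Finset.sum_apply, Finset.sum_mul]
  exact (norm_sum_le _ _).trans (Finset.sum_le_sum fun j _ => hterm i j n x)

lemma exists_mul_one_add_rpow_le {b : ℝ} (hb : b < 1) (C : ℝ) :
    ∃ K : ℝ, 0 ≤ K ∧ ∀ r : ℝ, 0 ≤ r → C * (1 + r) ^ b ≤ r / 2 + K := by
  have hc : (0 : ℝ) < 1 / (2 * (|C| + 1)) := by positivity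
  obtain ⟨U, hU⟩ := Filter.eventually_atTop.1
    ((tendsto_rpow_neg_atTop (sub_pos.2 hb)).eventually_le_const hc)
  refine ⟨|C| * |U| + 1 / 2, by positivity, fun r hr => ?_⟩
  have hu0 : 0 < 1 + r := by linarith
  have hpow : 0 ≤ (1 + r) ^ b := Real.rpow_nonneg hu0.le b
  refine (mul_le_mul_of_nonneg_right (le_abs_self C) hpow).trans ?_
  rcases le_total U (1 + r) with h | h
  · have h1 := hU _ h
    rw [neg_sub, Real.rpow_sub_one hu0.ne', div_le_div_iff₀ hu0 (by positivity)] at h1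
    have h2 : 0 ≤ |C| * |U| := by positivity
    nlinarith
  · have h1 : (1 + r) ^ b ≤ |U| := by
      calc (1 + r) ^ b ≤ (1 + r) ^ (1 : ℝ) :=
            Real.rpow_le_rpow_of_exponent_le (by linarith) hb.le
        _ = 1 + r := Real.rpow_one _
        _ ≤ |U| := h.trans (le_abs_self U)
    have h2 := mul_le_mul_of_nonneg_left h1 (abs_nonneg C)
    linarith

/-- A sublinear perturbation of an invertible linear map dilates a weight function by at most a
constant factor, up to an additive constant. -/
lemma IsWeightFunction.exists_weight_norm_le {ω : ℝ → ℝ} (hω : IsWeightFunction ω)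
    {E : Type*} [NormedAddCommGroup E] [NormedSpace ℝ E] (A : E ≃L[ℝ] E) {b : ℝ} (hb : b < 1)
    {θ : E → E} (hθ : ∃ C₀ > 0, ∀ x, ‖θ x‖ ≤ C₀ * (1 + ‖x‖) ^ b) :
    ∃ N : ℕ, 1 ≤ N ∧ ∃ R : ℝ, ∀ x, ω ‖x‖ ≤ N * ω ‖A x + θ x‖ + R := by
  obtain ⟨C₀, hC₀, hθ⟩ := hθ
  set L := ‖(A.symm : E →L[ℝ] E)‖
  obtain ⟨K, hK0, hK⟩ := exists_mul_one_add_rpow_le hb (L * C₀)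
  obtain ⟨N, hN⟩ := exists_nat_ge (2 * L)
  refine ⟨N + 1, by omega, ω (2 * K), fun x => ?_⟩
  have hL0 : 0 ≤ L := norm_nonneg _
  have h1 : ‖x‖ ≤ L * ‖A x‖ := by
    simpa using (A.symm : E →L[ℝ] E).le_opNorm (A x)
  have h2 : ‖A x‖ ≤ ‖A x + θ x‖ + ‖θ x‖ := by
    simpa using norm_sub_le (A x + θ x) (θ x)
  have h3 := mul_le_mul_of_nonneg_left (h2.trans (add_le_add_right (hθ x) _)) hL0
  have h4 := hK ‖x‖ (norm_nonneg x)
  have hr := norm_nonneg (A x + θ x)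
  have h5 : ‖x‖ ≤ ((N + 1 : ℕ) : ℝ) * ‖A x + θ x‖ + 2 * K := by
    push_cast
    nlinarith
  calc ω ‖x‖ ≤ ω (((N + 1 : ℕ) : ℝ) * ‖A x + θ x‖ + 2 * K) :=
        hω.monotone (norm_nonneg _) (Set.mem_Ici.2 (by positivity)) h5
    _ ≤ ω (((N + 1 : ℕ) : ℝ) * ‖A x + θ x‖) + ω (2 * K) :=
        hω.subadditive _ _ (by positivity) (by positivity)
    _ ≤ _ := by
        gcongr
        exact hω.natCast_mul_le (by omega) hr

/-- if `ψ(x) = Ax + θ(x)` with `A` an invertible linear map of `ℝ^d`,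
`∂θᵢ/∂xⱼ ∈ B_{L∞,ω}(ℝ^d)` for all `i,j` and `|θ(x)| = O(|x|^b)` for some
`b ∈ [0,1)`, then the composition operator `C_ψ : S_ω(ℝ^d) → S_ω(ℝ^d)` is well
defined. -/
theorem stmt18 (ω : ℝ → ℝ) (hω : IsWeightFunction ω) (d : ℕ)
    (A : EuclideanSpace ℝ (Fin d) ≃L[ℝ] EuclideanSpace ℝ (Fin d))
    (b : ℝ) (hb0 : 0 ≤ b) (hb1 : b < 1)
    (θ : EuclideanSpace ℝ (Fin d) → EuclideanSpace ℝ (Fin d)) (hθ : ContDiff ℝ (⊤ : ℕ∞) θ)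
    (hθ' : ∀ i j : Fin d, InBomega ω
      (fun x => fderiv ℝ (fun u => θ u i) x (EuclideanSpace.single j (1 : ℝ))))
    (hθb : ∃ C₀ > 0, ∀ x, ‖θ x‖ ≤ C₀ * (1 + ‖x‖) ^ b)
    (f : EuclideanSpace ℝ (Fin d) → ℂ) (hf : InSomegaD ω f) :
    InSomegaD ω (fun x => f (A x + θ x)) := by
  obtain ⟨hfs, hf⟩ := hf
  have hψ : ContDiff ℝ (⊤ : ℕ∞) (fun x => A x + θ x) :=
    (A : EuclideanSpace ℝ (Fin d) →L[ℝ] EuclideanSpace ℝ (Fin d)).contDiff.add hθ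
  refine ⟨hfs.comp hψ, fun lam hlam mu hmu => ?_⟩
  obtain ⟨N, hN, R, hR⟩ := hω.exists_weight_norm_le A hb1 hθb
  obtain ⟨m, hm⟩ := exists_nat_ge (max (2 * lam) 1)
  have hm1 : (1 : ℝ) ≤ m := (le_max_right _ _).trans hm
  have hm0 : (0 : ℝ) < m := by linarith
  have hm2 : ((2 : ℕ) : ℝ) * lam ≤ m := by
    push_cast
    exact (le_max_left _ _).trans hm
  obtain ⟨C, hC⟩ := exists_norm_iteratedFDeriv_add_le hω
    (A : EuclideanSpace ℝ (Fin d) →L[ℝ] EuclideanSpace ℝ (Fin d)) hθ hθ'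
    (by exact_mod_cast hm1 : 1 ≤ m)
  obtain ⟨K, hK⟩ := exists_nat_ge (max C 1)
  have hK1 : (1 : ℝ) ≤ K := (le_max_right _ _).trans hK
  have hN0 : (0 : ℝ) < N := by exact_mod_cast hN
  obtain ⟨D, hD⟩ := hf (K * m) (by positivity) (mu * N) (by positivity)
  refine ⟨|D| * Real.exp (mu * R), fun n x => ?_⟩
  have hinner : ∀ p : ℕ, 0 < p →
      ‖iteratedFDeriv ℝ p (fun x => A x + θ x) x‖ ≤ K * weightSeq ω m (p - 1) := by
    intro p hp
    obtain ⟨q, rfl⟩ := Nat.exists_eq_succ_of_ne_zero hp.ne'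
    refine (hC q x).trans ?_
    have := weightSeq_pos ω m q
    simp only [Nat.succ_eq_add_one, Nat.add_sub_cancel]
    gcongr
    exact (le_max_left _ _).trans hK
  obtain ⟨W, hW⟩ : ∃ W : ℝ, W = Real.exp (-(mu * N * ω ‖A x + θ x‖)) := ⟨_, rfl⟩
  have hW0 : 0 < W := hW ▸ Real.exp_pos _
  have houter : ∀ k : ℕ, ‖iteratedFDeriv ℝ k f (A x + θ x)‖
      ≤ |D| * W * weightSeq ω (K * m) k := by
    intro k
    refine (hD k (A x + θ x)).trans ?_
    rw [sub_eq_add_neg, Real.exp_add, weightSeq, mul_assoc |D|, mul_comm W, hW]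
    gcongr
    exact le_abs_self D
  have hWle : W ≤ Real.exp (mu * R) * Real.exp (-(mu * ω ‖x‖)) := by
    rw [hW, ← Real.exp_add, Real.exp_le_exp]
    have := mul_le_mul_of_nonneg_left (hR x) hmu.le
    nlinarith
  have hterm : ∀ c : OrderedFinpartition n, ‖iteratedFDeriv ℝ c.length f (A x + θ x)‖
        * ∏ i, ‖iteratedFDeriv ℝ (c.partSize i) (fun x => A x + θ x) x‖
      ≤ |D| * W * (weightSeq ω m c.length * ∏ i, weightSeq ω m (c.partSize i - 1)) := by
    intro c
    have hprod : ∏ i, ‖iteratedFDeriv ℝ (c.partSize i) (fun x => A x + θ x) x‖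
        ≤ (K : ℝ) ^ c.length * ∏ i, weightSeq ω m (c.partSize i - 1) := by
      calc _ ≤ ∏ i, (K * weightSeq ω m (c.partSize i - 1)) :=
            Finset.prod_le_prod (fun i _ => norm_nonneg _)
              fun i _ => hinner _ (c.partSize_pos i)
        _ = _ := by simp [Finset.prod_mul_distrib]
    have hpow := hω.pow_mul_weightSeq_le (by exact_mod_cast hK1 : 1 ≤ K) hm0 le_rfl c.length
    have hP : 0 ≤ ∏ i, weightSeq ω m (c.partSize i - 1) :=
      Finset.prod_nonneg fun i _ => (weightSeq_pos ω m _).le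
    have hw := weightSeq_pos ω (K * m) c.length
    calc _ ≤ (|D| * W * weightSeq ω (K * m) c.length)
          * ((K : ℝ) ^ c.length * ∏ i, weightSeq ω m (c.partSize i - 1)) :=
          mul_le_mul (houter _) hprod (Finset.prod_nonneg fun i _ => norm_nonneg _)
            (by positivity)
      _ = |D| * W * (((K : ℝ) ^ c.length * weightSeq ω (K * m) c.length)
          * ∏ i, weightSeq ω m (c.partSize i - 1)) := by ring
      _ ≤ _ := mul_le_mul_of_nonneg_left (mul_le_mul_of_nonneg_right hpow hP) (by positivity)
  have hsum := hω.sum_orderedFinpartition_weightSeq_le hm0 n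
  have hlast := hω.pow_mul_weightSeq_le (by norm_num : 1 ≤ 2) hlam hm2 n
  push_cast at hlast
  calc ‖iteratedFDeriv ℝ n (fun x => f (A x + θ x)) x‖
      ≤ ∑ c : OrderedFinpartition n, ‖iteratedFDeriv ℝ c.length f (A x + θ x)‖
        * ∏ i, ‖iteratedFDeriv ℝ (c.partSize i) (fun x => A x + θ x) x‖ :=
        norm_iteratedFDeriv_comp_le_sum_orderedFinpartition hfs hψ n x
    _ ≤ ∑ c : OrderedFinpartition n,
        |D| * W * (weightSeq ω m c.length * ∏ i, weightSeq ω m (c.partSize i - 1)) :=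
        Finset.sum_le_sum fun c _ => hterm c
    _ ≤ |D| * W * weightSeq ω lam n := by
        rw [← Finset.mul_sum]
        gcongr
        exact hsum.trans hlast
    _ ≤ |D| * (Real.exp (mu * R) * Real.exp (-(mu * ω ‖x‖))) * weightSeq ω lam n := by
        have := weightSeq_pos ω lam n
        gcongr
    _ = |D| * Real.exp (mu * R)
        * Real.exp (lam * youngConj ω ((n : ℝ) / lam) - mu * ω ‖x‖) := by
        rw [sub_eq_add_neg, Real.exp_add, weightSeq]
        ring
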